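/- For every integer n ≥ 3, any set of at most n points in ℝ² whose pairwise Euclidean distances are all at most 1 has convex hull of 2-dimensional Lebesgue measure at most n · sin²(π/(2n)) · cos(π/n)/sin(π/n). In particular, A*_n ≤ n · sin²(π/(2n)) · cot(π/n) for all n ≥ 3 (this gives the numerical upper bounds 0.76893595 for n = 14 and 0.77279135 for n = 16 used in the paper). -/

import Mathlib

open MeasureTheory Real

/-- `maxArea n` is the supremum of the areas (2-dimensional Lebesgue measures of convex
hulls) of sets of at most `n` points in the Euclidean plane whose pairwise Euclidean
distances are all at most `1`. -/
noncomputable def maxArea (n : ℕ) : ℝ :=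
  sSup {a : ℝ | ∃ P : Finset (EuclideanSpace ℝ (Fin 2)),
    P.card ≤ n ∧ (∀ p ∈ P, ∀ q ∈ P, dist p q ≤ 1) ∧
    a = (volume (convexHull ℝ (P : Set (EuclideanSpace ℝ (Fin 2))))).toReal}


lemma sin_sum_le (n : ℕ) (hn : 0 < n) (t : ℕ → ℝ) (h0 : ∀ k < n, 0 ≤ t k) (h1 : ∀ k < n, t k ≤ π)
    (hs : ∑ k ∈ Finset.range n, t k = π) :
    ∑ k ∈ Finset.range n, sin (t k / 2) ≤ n * sin (π / (2 * n)) := by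
  have hn' : (0 : ℝ) < n := by exact_mod_cast hn
  have := strictConcaveOn_sin_Icc.concaveOn.le_map_sum (t := Finset.range n)
    (w := fun _ => (1 / n : ℝ)) (p := fun k => t k / 2) (by intros; positivity)
    (by simp; field_simp) (by
      intro i hi
      have hi := Finset.mem_range.1 hi
      constructor
      · have := h0 i hi; linarith
      · have := h1 i hi; linarith [pi_pos])
  simp only [smul_eq_mul, ← Finset.mul_sum, ← Finset.sum_div, hs] at this
  have e : 1 / (n : ℝ) * (π / 2) = π / (2 * n) := by field_simp
  rw [e] at this
  calc _ = n * (1 / n * ∑ k ∈ Finset.range n, sin (t k / 2)) := by field_simp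
    _ ≤ _ := by gcongr

lemma tele_cos (n i : ℕ) (hi : i < n) (b : ℕ → ℝ) (hb : ∀ k < n, b k ≤ b (k + 1))
    (hτ : ∀ k < n, b (k + 1) - b k ≤ π)
    (hbn : b n = b 0 + π) :
    2 ≤ ∑ k ∈ Finset.range n, 2 * sin ((b (k + 1) - b k) / 2) * |sin ((b k + b (k + 1)) / 2 - b i)| := by
  have key : ∀ k, 2 * sin ((b (k + 1) - b k) / 2) * sin ((b k + b (k + 1)) / 2 - b i)
      = cos (b k - b i) - cos (b (k + 1) - b i) := by
    intro k
    rw [Real.cos_sub_cos]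
    rw [show (b k - b i + (b (k + 1) - b i)) / 2 = (b k + b (k + 1)) / 2 - b i by ring,
      show (b k - b i - (b (k + 1) - b i)) / 2 = -((b (k + 1) - b k) / 2) by ring, sin_neg]
    ring
  have hpos : ∀ k < n, 0 ≤ 2 * sin ((b (k + 1) - b k) / 2) := by
    intro k hk
    have := sin_nonneg_of_nonneg_of_le_pi (x := (b (k + 1) - b k) / 2)
      (by linarith [hb k hk]) (by linarith [hτ k hk, pi_pos])
    linarith
  rw [Finset.range_eq_Ico, ← Finset.sum_Ico_consecutive _ (Nat.zero_le i) hi.le]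
  have A : ∑ k ∈ Finset.Ico 0 i, (cos (b (k + 1) - b i) - cos (b k - b i)) ≤ ∑ k ∈ Finset.Ico 0 i,
      2 * sin ((b (k + 1) - b k) / 2) * |sin ((b k + b (k + 1)) / 2 - b i)| := by
    apply Finset.sum_le_sum
    intro k hk
    have hk := Finset.mem_Ico.1 hk
    have := mul_le_mul_of_nonneg_left (neg_le_abs (sin ((b k + b (k + 1)) / 2 - b i)))
      (hpos k (by omega))
    linarith [key k]
  have B : ∑ k ∈ Finset.Ico i n, -(cos (b (k + 1) - b i) - cos (b k - b i)) ≤ ∑ k ∈ Finset.Ico i n,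
      2 * sin ((b (k + 1) - b k) / 2) * |sin ((b k + b (k + 1)) / 2 - b i)| := by
    apply Finset.sum_le_sum
    intro k hk
    have hk := Finset.mem_Ico.1 hk
    have := mul_le_mul_of_nonneg_left (le_abs_self (sin ((b k + b (k + 1)) / 2 - b i)))
      (hpos k (by omega))
    linarith [key k]
  rw [Finset.sum_Ico_sub (fun k => cos (b k - b i)) (Nat.zero_le i)] at A
  rw [Finset.sum_neg_distrib, Finset.sum_Ico_sub (fun k => cos (b k - b i)) hi.le] at B
  have : cos (b n - b i) = - cos (b 0 - b i) := by
    rw [hbn, show b 0 + π - b i = b 0 - b i + π by ring, cos_add_pi]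
  simp only [sub_self, cos_zero] at A B
  linarith

lemma reinhardt_core (n : ℕ) (hn : 0 < n) (b l : ℕ → ℝ) (hl : ∀ i < n, 0 ≤ l i)
    (hb : ∀ k < n, b k ≤ b (k + 1)) (hbn : b n = b 0 + π)
    (hw : ∀ θ, ∑ i ∈ Finset.range n, l i * |sin (θ - b i)| ≤ 2) :
    ∑ i ∈ Finset.range n, l i ≤ 2 * n * sin (π / (2 * n)) := by
  have hsum : ∑ k ∈ Finset.range n, (b (k + 1) - b k) = π := by
    rw [Finset.sum_range_sub, hbn]; ring
  have hτ : ∀ k < n, b (k + 1) - b k ≤ π := by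
    intro k hk
    rw [← hsum]
    exact Finset.single_le_sum (f := fun k => b (k + 1) - b k)
      (fun i hi => by have := hb i (Finset.mem_range.1 hi); linarith) (Finset.mem_range.2 hk)
  have J := sin_sum_le n hn (fun k => b (k + 1) - b k)
    (fun k hk => by have := hb k hk; linarith) hτ hsum
  have h1 : ∑ i ∈ Finset.range n, l i * 2 ≤ ∑ i ∈ Finset.range n, l i *
      ∑ k ∈ Finset.range n, 2 * sin ((b (k + 1) - b k) / 2) * |sin ((b k + b (k + 1)) / 2 - b i)| := by
    apply Finset.sum_le_sum
    intro i hi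
    have hi := Finset.mem_range.1 hi
    exact mul_le_mul_of_nonneg_left (tele_cos n i hi b hb hτ hbn) (hl i hi)
  have h2 : ∑ i ∈ Finset.range n, l i *
      ∑ k ∈ Finset.range n, 2 * sin ((b (k + 1) - b k) / 2) * |sin ((b k + b (k + 1)) / 2 - b i)|
      = ∑ k ∈ Finset.range n, 2 * sin ((b (k + 1) - b k) / 2) *
        ∑ i ∈ Finset.range n, l i * |sin ((b k + b (k + 1)) / 2 - b i)| := by
    simp only [Finset.mul_sum]
    rw [Finset.sum_comm]
    refine Finset.sum_congr rfl fun _ _ => Finset.sum_congr rfl fun _ _ => by ring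
  have h3 : ∑ k ∈ Finset.range n, 2 * sin ((b (k + 1) - b k) / 2) *
        ∑ i ∈ Finset.range n, l i * |sin ((b k + b (k + 1)) / 2 - b i)|
      ≤ ∑ k ∈ Finset.range n, 2 * sin ((b (k + 1) - b k) / 2) * 2 := by
    apply Finset.sum_le_sum
    intro k hk
    have hk := Finset.mem_range.1 hk
    apply mul_le_mul_of_nonneg_left (hw _)
    have := sin_nonneg_of_nonneg_of_le_pi (x := (b (k + 1) - b k) / 2)
      (by linarith [hb k hk]) (by linarith [hτ k hk, pi_pos])
    linarith
  rw [← Finset.sum_mul] at h1 h3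
  rw [← Finset.mul_sum] at h3
  linarith

/-- every complex number is, up to sign, of the form `r e^{iβ}` with `β ∈ [0, π)`. -/
lemma polar_mod_pi (z : ℂ) : ∃ β : ℝ, 0 ≤ β ∧ β ≤ π ∧
    ∀ θ : ℝ, |z.re * sin θ - z.im * cos θ| = ‖z‖ * |sin (θ - β)| := by
  have hre : z.re = ‖z‖ * cos z.arg := (Complex.norm_mul_cos_arg z).symm
  have him : z.im = ‖z‖ * sin z.arg := (Complex.norm_mul_sin_arg z).symm
  have main : ∀ θ : ℝ, |z.re * sin θ - z.im * cos θ| = ‖z‖ * |sin (θ - z.arg)| := by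
    intro θ
    have e : ‖z‖ * |sin (θ - z.arg)| = |‖z‖ * sin (θ - z.arg)| := by
      rw [abs_mul, abs_of_nonneg (norm_nonneg z)]
    rw [e, sin_sub]
    congr 1
    nth_rewrite 1 [hre]
    nth_rewrite 1 [him]
    ring
  by_cases h : 0 ≤ z.arg
  · exact ⟨z.arg, h, Complex.arg_le_pi z, main⟩
  · refine ⟨z.arg + π, by linarith [Complex.neg_pi_lt_arg z], by linarith, fun θ => ?_⟩
    rw [main θ, show θ - (z.arg + π) = θ - z.arg - π by ring, sin_sub_pi, abs_neg]

lemma reinhardt (n : ℕ) (hn : 0 < n) (e : ℕ → ℂ)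
    (hw : ∀ θ : ℝ, ∑ i ∈ Finset.range n, |(e i).re * sin θ - (e i).im * cos θ| ≤ 2) :
    ∑ i ∈ Finset.range n, ‖e i‖ ≤ 2 * n * sin (π / (2 * n)) := by
  choose β h0 h1 hβ using fun i => polar_mod_pi (e i)
  let f : Fin n → ℝ := fun i => β i
  let σ := Tuple.sort f
  have hmono : Monotone (f ∘ σ) := Tuple.monotone_sort f
  let b : ℕ → ℝ := fun k => if h : k < n then f (σ ⟨k, h⟩) else f (σ ⟨0, hn⟩) + π
  let l : ℕ → ℝ := fun k => if h : k < n then ‖e (σ ⟨k, h⟩)‖ else 0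
  have perm : ∀ g : ℕ → ℝ, ∑ i ∈ Finset.range n, g i = ∑ i : Fin n, g (σ i) := by
    intro g
    rw [Finset.sum_range]
    exact (Equiv.sum_comp σ (fun i : Fin n => g i)).symm
  have key := reinhardt_core n hn b l (by intro i hi; simp only [l, hi, dif_pos]; positivity) (by
      intro k hk
      by_cases hk1 : k + 1 < n
      · simp only [b, hk, hk1, dif_pos]
        exact hmono (by simp [Fin.le_def])
      · simp only [b, hk, hk1, dif_pos, dif_neg, not_false_eq_true]
        have := h1 (σ ⟨k, hk⟩)
        have := h0 (σ ⟨0, hn⟩)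
        simp only [f]; linarith)
    (by simp [b, hn]) (by
      intro θ
      refine le_trans (le_of_eq ?_) (hw θ)
      rw [perm (fun i => |(e i).re * sin θ - (e i).im * cos θ|), Finset.sum_range]
      refine Finset.sum_congr rfl fun i _ => ?_
      simp only [b, l, i.2, dif_pos, hβ, f])
  refine le_trans (le_of_eq ?_) key
  rw [perm, Finset.sum_range]
  refine Finset.sum_congr rfl fun i _ => ?_
  simp [l]


/-- planar cross product -/
noncomputable def crs (a b : ℂ) : ℝ := a.re * b.im - a.im * b.re

lemma nsq (a : ℂ) : ‖a‖ ^ 2 = a.re ^ 2 + a.im ^ 2 := by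
  rw [Complex.sq_norm, Complex.normSq_apply]; ring

lemma merge_ineq (x y : ℝ) (hx : 0 < sin x) (hy : 0 < sin y) (hxy : 0 < sin (x + y)) (a b : ℂ) :
    cos (x + y) / sin (x + y) * ‖a + b‖ ^ 2 + 2 * crs a b
      ≤ cos x / sin x * ‖a‖ ^ 2 + cos y / sin y * ‖b‖ ^ 2 := by
  have hs := sin_add x y
  have hc := cos_add x y
  have h1 := sin_sq_add_cos_sq x
  have h2 := sin_sq_add_cos_sq y
  rw [nsq, nsq, nsq]
  simp only [Complex.add_re, Complex.add_im, crs]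
  set s := sin x
  set t := sin y
  set c := cos x
  set d := cos y
  set S := sin (x + y)
  set C := cos (x + y)
  have e1 : t = S * c - C * s := by
    rw [hs, hc]; linear_combination (-t) * h1
  have e2 : s = S * d - C * t := by
    rw [hs, hc]; linear_combination (-s) * h2
  have e3 : S ^ 2 + C ^ 2 = 1 := sin_sq_add_cos_sq (x + y)
  have id : c / s * (a.re ^ 2 + a.im ^ 2) + d / t * (b.re ^ 2 + b.im ^ 2)
      - (C / S * ((a.re + b.re) ^ 2 + (a.im + b.im) ^ 2) + 2 * (a.re * b.im - a.im * b.re))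
      = ((t * a.re - s * (C * b.re + S * b.im)) ^ 2 + (t * a.im - s * (C * b.im - S * b.re)) ^ 2)
        / (s * t * S) := by
    have f1 : c / s - C / S = t / (s * S) := by field_simp; linarith
    have f2 : d / t - C / S = s / (t * S) := by field_simp; linarith
    have : c / s = t / (s * S) + C / S := by linarith
    rw [this]
    have : d / t = s / (t * S) + C / S := by linarith
    rw [this]
    field_simp
    linear_combination (-(s ^ 2) * (b.re ^ 2 + b.im ^ 2)) * e3
  have : 0 ≤ ((t * a.re - s * (C * b.re + S * b.im)) ^ 2 + (t * a.im - s * (C * b.im - S * b.re)) ^ 2)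
        / (s * t * S) := by positivity
  linarith

lemma wirtinger_aux (n : ℕ) (hn : 3 ≤ n) (z : ℕ → ℂ) (h0 : z 0 = 0) (k : ℕ) (hk : k + 1 < n) :
    cos ((k + 1 : ℕ) * (π / n)) / sin ((k + 1 : ℕ) * (π / n)) * ‖z (k + 1)‖ ^ 2
      + 2 * ∑ i ∈ Finset.range (k + 1), crs (z i) (z (i + 1))
      ≤ cos (π / n) / sin (π / n) * ∑ i ∈ Finset.range (k + 1), ‖z (i + 1) - z i‖ ^ 2 := by
  have hn' : (0 : ℝ) < n := by exact_mod_cast (by omega : 0 < n)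
  have hpos : ∀ j : ℕ, 0 < j → j < n → 0 < sin (j * (π / n)) := by
    intro j hj hjn
    have : (0 : ℝ) < j := by exact_mod_cast hj
    have h2 : (j : ℝ) < n := by exact_mod_cast hjn
    apply sin_pos_of_pos_of_lt_pi
    · have := pi_pos; positivity
    · rw [mul_div_assoc', div_lt_iff₀ hn']
      nlinarith [pi_pos]
  induction k with
  | zero => simp [h0, crs]
  | succ k ih =>
    have ih := ih (by omega)
    have e : ((k + 1 + 1 : ℕ) : ℝ) * (π / n) = (k + 1 : ℕ) * (π / n) + π / n := by push_cast; ring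
    have m := merge_ineq ((k + 1 : ℕ) * (π / n)) (π / n) (hpos _ (by omega) (by omega))
      (by simpa using hpos 1 (by omega) (by omega)) (by rw [← e]; exact hpos _ (by omega) hk)
      (z (k + 1)) (z (k + 1 + 1) - z (k + 1))
    rw [← e, add_sub_cancel] at m
    rw [Finset.sum_range_succ, Finset.sum_range_succ (n := k + 1), mul_add (cos (π / n) / sin (π / n))]
    have : crs (z (k + 1)) (z (k + 1 + 1) - z (k + 1)) = crs (z (k + 1)) (z (k + 1 + 1)) := by
      simp [crs]; ring
    rw [this] at m
    linarith

lemma wirtinger (n : ℕ) (hn : 3 ≤ n) (z : ℕ → ℂ) (h0 : z 0 = 0) (hz : z n = 0) :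
    2 * ∑ i ∈ Finset.range n, crs (z i) (z (i + 1))
      ≤ cos (π / n) / sin (π / n) * ∑ i ∈ Finset.range n, ‖z (i + 1) - z i‖ ^ 2 := by
  obtain ⟨k, rfl⟩ : ∃ k, n = k + 1 + 1 := ⟨n - 2, by omega⟩
  have := wirtinger_aux _ hn z h0 k (by omega)
  have hn' : (((k + 1 + 1 : ℕ) : ℝ)) ≠ 0 := by positivity
  have e : ((k + 1 : ℕ) : ℝ) * (π / (k + 1 + 1 : ℕ)) = π - π / (k + 1 + 1 : ℕ) := by
    field_simp; push_cast; ring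
  rw [e, cos_pi_sub, sin_pi_sub] at this
  rw [Finset.sum_range_succ, Finset.sum_range_succ (n := k + 1), hz]
  have : crs (z (k + 1)) 0 = 0 := by simp [crs]
  rw [this, zero_sub, norm_neg]
  rw [neg_div] at *
  linarith

lemma isosceles (p q r : ℂ) : ∃ w : ℂ, ‖w - p‖ = (‖q - p‖ + ‖r - q‖) / 2 ∧
    ‖r - w‖ = (‖q - p‖ + ‖r - q‖) / 2 ∧ crs p q + crs q r ≤ crs p w + crs w r := by
  set s := ‖q - p‖ + ‖r - q‖ with hs
  have hs0 : 0 ≤ s := by positivity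
  have hc : ‖r - p‖ ≤ s := by
    have := norm_add_le (r - q) (q - p)
    rw [sub_add_sub_cancel] at this; linarith
  have mk : ∀ v : ℂ, ‖v‖ ^ 2 = (s / 2) ^ 2 → ‖v‖ = s / 2 := fun v h =>
    (sq_eq_sq₀ (norm_nonneg _) (by positivity)).1 h
  have hq : (q.re - p.re) ^ 2 + (q.im - p.im) ^ 2 = ‖q - p‖ ^ 2 := by rw [nsq]; simp
  have hr : (r.re - q.re) ^ 2 + (r.im - q.im) ^ 2 = ‖r - q‖ ^ 2 := by rw [nsq]; simp
  by_cases h : r = p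
  · subst h
    refine ⟨r + (s / 2 : ℝ), ?_, ?_, ?_⟩
    · rw [add_sub_cancel_left, Complex.norm_real, norm_of_nonneg (by positivity)]
    · rw [sub_add_cancel_left, norm_neg, Complex.norm_real, norm_of_nonneg (by positivity)]
    · simp [crs]; linarith
  · have hd : 0 < ‖r - p‖ := norm_pos_iff.2 (sub_ne_zero.2 h)
    set c := ‖r - p‖ with hcdef
    have hc2 : (r.re - p.re) ^ 2 + (r.im - p.im) ^ 2 = c ^ 2 := by rw [nsq]; simp
    set X := r.re - p.re with hX
    set Y := r.im - p.im with hY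
    set y := √(s ^ 2 - c ^ 2) / 2 with hy
    have hy2 : y ^ 2 = (s ^ 2 - c ^ 2) / 4 := by
      rw [hy, div_pow, sq_sqrt (by nlinarith)]; ring
    have hy0 : 0 ≤ y := by positivity
    let w : ℂ := ⟨p.re + X / 2 + y * Y / c, p.im + Y / 2 - y * X / c⟩
    have hcc : (Y / c) ^ 2 + (X / c) ^ 2 = 1 := by field_simp; linarith
    refine ⟨w, mk _ ?_, mk _ ?_, ?_⟩
    · rw [nsq]; simp only [w, Complex.sub_re, Complex.sub_im]
      linear_combination (y ^ 2) * hcc + hy2 + hc2 / 4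
    · rw [nsq]; simp only [w, Complex.sub_re, Complex.sub_im]
      linear_combination (y ^ 2) * hcc + hy2 + hc2 / 4
    · show _ ≤ _
      have hw : crs p w + crs w r = crs p r + y * c := by
        simp only [crs, w]
        have : y * c = y * (X * X / c + Y * Y / c) := by
          congr 1; field_simp; linarith
        rw [this, hX, hY]; field_simp; ring
      rw [hw]
      have h4 : ((crs p q + crs q r - crs p r)) ^ 2 ≤ (y * c) ^ 2 := by
        rw [mul_pow, hy2]
        set a := ‖q - p‖
        set b := ‖r - q‖
        have ha : 0 ≤ a := norm_nonneg _
        have hb : 0 ≤ b := norm_nonneg _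
        set t := (q.re - p.re) * (r.re - q.re) + (q.im - p.im) * (r.im - q.im) with ht
        have k1 : c ^ 2 = a ^ 2 + b ^ 2 + 2 * t := by
          rw [← hc2, ← hq, ← hr, ht, hX, hY]; ring
        have k2 : (crs p q + crs q r - crs p r) ^ 2 = a ^ 2 * b ^ 2 - t ^ 2 := by
          rw [← hq, ← hr, ht]; simp only [crs]; ring
        have k0 : t ^ 2 ≤ (a * b) ^ 2 := by
          have := sq_nonneg (crs p q + crs q r - crs p r)
          rw [k2] at this
          rw [mul_pow]; linarith
        have k3 : t ≤ a * b := (abs_le_of_sq_le_sq' k0 (by positivity)).2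
        rw [k2, k1, hs]
        have := mul_nonneg (sub_nonneg.2 k3) (sq_nonneg (a - b))
        linarith
      have := abs_le_of_sq_le_sq' h4 (by positivity)
      linarith [this.2]


lemma update_sum (n k : ℕ) (hk : k + 1 < n) (z : ℕ → ℂ) (w : ℂ) (g : ℂ → ℂ → ℝ) :
    ∑ i ∈ Finset.range n, g (Function.update z (k + 1) w i) (Function.update z (k + 1) w (i + 1))
      = ∑ i ∈ Finset.range n, g (z i) (z (i + 1)) - g (z k) (z (k + 1)) - g (z (k + 1)) (z (k + 2))
        + g (z k) w + g w (z (k + 2)) := by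
  have split : ∀ f : ℕ → ℝ, ∑ i ∈ Finset.range n, f i =
      f k + (f (k + 1) + ∑ i ∈ ((Finset.range n).erase k).erase (k + 1), f i) := by
    intro f
    rw [Finset.add_sum_erase _ _ (by simp; omega), Finset.add_sum_erase _ _ (by simp; omega)]
  rw [split, split (fun i => g (z i) (z (i + 1)))]
  have : ∑ i ∈ ((Finset.range n).erase k).erase (k + 1),
      g (Function.update z (k + 1) w i) (Function.update z (k + 1) w (i + 1))
      = ∑ i ∈ ((Finset.range n).erase k).erase (k + 1), g (z i) (z (i + 1)) := by
    refine Finset.sum_congr rfl fun i hi => ?_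
    simp only [Finset.mem_erase] at hi
    rw [Function.update_of_ne hi.1, Function.update_of_ne (by omega)]
  rw [this, Function.update_self, Function.update_of_ne (by omega), Function.update_of_ne (by omega)]
  ring

lemma path_bound (n : ℕ) (z : ℕ → ℂ) (h0 : z 0 = 0) (k : ℕ) (hk : k ≤ n) :
    ‖z k‖ ≤ ∑ i ∈ Finset.range n, ‖z (i + 1) - z i‖ := by
  have h : z k = ∑ i ∈ Finset.range k, (z (i + 1) - z i) := by
    rw [Finset.sum_range_sub, h0, sub_zero]
  rw [h]
  refine (norm_sum_le _ _).trans ?_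
  exact Finset.sum_le_sum_of_subset_of_nonneg (by simpa using hk) (fun _ _ _ => norm_nonneg _)

/-- Isoperimetric inequality for closed `n`-gons. -/
lemma isoperimetric (n : ℕ) (hn : 3 ≤ n) (z : ℕ → ℂ) (h0 : z 0 = 0) (hz : ∀ k, n ≤ k → z k = 0)
    (L : ℝ) (hL : ∑ i ∈ Finset.range n, ‖z (i + 1) - z i‖ ≤ L) :
    2 * ∑ i ∈ Finset.range n, crs (z i) (z (i + 1)) ≤ cos (π / n) / sin (π / n) * (L ^ 2 / n) := by
  set S0 := ∑ i ∈ Finset.range n, crs (z i) (z (i + 1)) with hS0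
  let K : Set (ℕ → ℂ) := {y | y 0 = 0 ∧ (∀ k, n ≤ k → y k = 0) ∧
    ∑ i ∈ Finset.range n, ‖y (i + 1) - y i‖ ≤ L ∧
    S0 ≤ ∑ i ∈ Finset.range n, crs (y i) (y (i + 1))}
  have hn' : (0 : ℝ) < n := by exact_mod_cast (by omega : 0 < n)
  have hL0 : 0 ≤ L := le_trans (Finset.sum_nonneg fun _ _ => norm_nonneg _) hL
  have hclosed : IsClosed K := by
    have c1 : IsClosed {y : ℕ → ℂ | y 0 = 0} := isClosed_eq (by fun_prop) (by fun_prop)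
    have c2 : IsClosed {y : ℕ → ℂ | ∀ k, n ≤ k → y k = 0} := by
      simp only [Set.ofPred_forall]
      refine isClosed_iInter fun k => isClosed_iInter fun _ => isClosed_eq (by fun_prop) (by fun_prop)
    have c3 : IsClosed {y : ℕ → ℂ | ∑ i ∈ Finset.range n, ‖y (i + 1) - y i‖ ≤ L} :=
      isClosed_le (by fun_prop) (by fun_prop)
    have c4 : IsClosed {y : ℕ → ℂ | S0 ≤ ∑ i ∈ Finset.range n, crs (y i) (y (i + 1))} := by
      refine isClosed_le (by fun_prop) ?_
      refine continuous_finsetSum _ fun i _ => ?_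
      have a : ∀ j, Continuous fun y : ℕ → ℂ => (y j).re :=
        fun j => Complex.continuous_re.comp (continuous_apply j)
      have b : ∀ j, Continuous fun y : ℕ → ℂ => (y j).im :=
        fun j => Complex.continuous_im.comp (continuous_apply j)
      exact ((a _).mul (b _)).sub ((b _).mul (a _))
    exact c1.inter (c2.inter (c3.inter c4))
  have hcomp : IsCompact K := by
    refine (isCompact_univ_pi (fun _ : ℕ => isCompact_closedBall (0 : ℂ) L)).of_isClosed_subset
      hclosed ?_
    rintro y ⟨y0, yn, yL, -⟩ k -
    rw [mem_closedBall_zero_iff]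
    by_cases hk : k ≤ n
    · exact (path_bound n y y0 k hk).trans yL
    · rw [yn k (by omega), norm_zero]; exact hL0
  obtain ⟨y, ⟨y0, yn, yL, yS⟩, ymin⟩ := hcomp.exists_isMinOn ⟨z, h0, hz, hL, le_refl _⟩
    (f := fun y => ∑ i ∈ Finset.range n, ‖y (i + 1) - y i‖ ^ 2)
    (Continuous.continuousOn (by fun_prop))
  have eqn : ∀ k, k + 1 < n → ‖y (k + 1) - y k‖ = ‖y (k + 2) - y (k + 1)‖ := by
    intro k hk
    obtain ⟨w, w1, w2, w3⟩ := isosceles (y k) (y (k + 1)) (y (k + 2))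
    have hmem : Function.update y (k + 1) w ∈ K := by
      refine ⟨?_, ?_, ?_, ?_⟩
      · rw [Function.update_of_ne (by omega), y0]
      · intro j hj
        rw [Function.update_of_ne (by omega), yn j hj]
      · rw [update_sum n k hk y w (fun a b => ‖b - a‖), w1, w2]
        linarith
      · rw [update_sum n k hk y w crs]
        linarith
    have := ymin hmem
    simp only [Set.mem_ofPred_eq] at this
    rw [update_sum n k hk y w (fun a b => ‖b - a‖ ^ 2), w1, w2] at this
    have h : (‖y (k + 1) - y k‖ - ‖y (k + 2) - y (k + 1)‖) ^ 2 ≤ 0 := by linarith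
    have := pow_eq_zero_iff (two_ne_zero) |>.1 (le_antisymm h (sq_nonneg _))
    linarith
  have all : ∀ k, k < n → ‖y (k + 1) - y k‖ = ‖y 1 - y 0‖ := by
    intro k
    induction k with
    | zero => simp
    | succ k ih => intro hk; rw [← ih (by omega)]; exact (eqn k hk).symm
  have hW := wirtinger n hn y y0 (yn n le_rfl)
  rw [Finset.sum_congr rfl (f := fun i => ‖y (i + 1) - y i‖ ^ 2) (g := fun _ => ‖y 1 - y 0‖ ^ 2)
    (fun i hi => by rw [all i (Finset.mem_range.1 hi)])] at hW
  rw [Finset.sum_congr rfl (g := fun _ => ‖y 1 - y 0‖)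
    (fun i hi => by rw [all i (Finset.mem_range.1 hi)])] at yL
  simp only [Finset.sum_const, Finset.card_range, nsmul_eq_mul] at hW yL
  have hcot : 0 ≤ cos (π / n) / sin (π / n) := by
    have h3 : (3 : ℝ) ≤ n := by exact_mod_cast hn
    have : π / n ≤ π / 2 := div_le_div_of_nonneg_left pi_pos.le (by norm_num) (by linarith)
    have p : 0 ≤ π / n := by positivity
    exact div_nonneg (cos_nonneg_of_neg_pi_div_two_le_of_le (by linarith [pi_pos]) this)
      (sin_nonneg_of_nonneg_of_le_pi p (by linarith [pi_pos]))
  have : n * ‖y 1 - y 0‖ ^ 2 ≤ L ^ 2 / n := by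
    rw [le_div_iff₀ hn']
    have := pow_le_pow_left₀ (by positivity) yL 2
    linarith
  have := mul_le_mul_of_nonneg_left this hcot
  linarith


/-- orientation determinant of three points in the plane -/
noncomputable def orient (a b c : EuclideanSpace ℝ (Fin 2)) : ℝ :=
  (b 0 - a 0) * (c 1 - a 1) - (b 1 - a 1) * (c 0 - a 0)

lemma E_ext {x y : EuclideanSpace ℝ (Fin 2)} (h0 : x 0 = y 0) (h1 : x 1 = y 1) : x = y := by
  ext i; fin_cases i <;> assumption

/-- the closed triangle -/
def triSet (a b c : EuclideanSpace ℝ (Fin 2)) : Set (EuclideanSpace ℝ (Fin 2)) :=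
  {x | ∃ s t : ℝ, 0 ≤ s ∧ 0 ≤ t ∧ s + t ≤ 1 ∧ x = a + s • (b - a) + t • (c - a)}

lemma volume_stdtri : volume {x : ℝ × ℝ | 0 ≤ x.1 ∧ 0 ≤ x.2 ∧ x.1 + x.2 ≤ 1} ≤ ENNReal.ofReal (1 / 2) := by
  have hm : MeasurableSet {x : ℝ × ℝ | 0 ≤ x.1 ∧ 0 ≤ x.2 ∧ x.1 + x.2 ≤ 1} := by
    apply IsClosed.measurableSet
    have c1 : IsClosed {x : ℝ × ℝ | 0 ≤ x.1} := isClosed_le (by fun_prop) (by fun_prop)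
    have c2 : IsClosed {x : ℝ × ℝ | 0 ≤ x.2} := isClosed_le (by fun_prop) (by fun_prop)
    have c3 : IsClosed {x : ℝ × ℝ | x.1 + x.2 ≤ 1} := isClosed_le (by fun_prop) (by fun_prop)
    exact c1.inter (c2.inter c3)
  rw [Measure.volume_eq_prod, Measure.prod_apply hm]
  have h1 : ∀ x : ℝ, volume (Prod.mk x ⁻¹' {x : ℝ × ℝ | 0 ≤ x.1 ∧ 0 ≤ x.2 ∧ x.1 + x.2 ≤ 1})
      ≤ (Set.Icc (0 : ℝ) 1).indicator (fun x => ENNReal.ofReal (1 - x)) x := by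
    intro x
    by_cases hx : x ∈ Set.Icc (0 : ℝ) 1
    · rw [Set.indicator_of_mem hx]
      refine (measure_mono (t := Set.Icc 0 (1 - x)) ?_).trans ?_
      · rintro y ⟨-, h2, h3⟩
        exact ⟨h2, by simp only at h3; linarith⟩
      · rw [Real.volume_Icc, sub_zero]
    · rw [Set.indicator_of_notMem hx, nonpos_iff_eq_zero]
      refine measure_mono_null (t := ∅) ?_ measure_empty
      rintro y ⟨h1, h2, h3⟩
      exact hx ⟨h1, by simp only at h2 h3; linarith⟩
  refine (lintegral_mono h1).trans ?_
  rw [lintegral_indicator measurableSet_Icc, ← ofReal_integral_eq_lintegral_ofReal]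
  · rw [integral_Icc_eq_integral_Ioc, ← intervalIntegral.integral_of_le zero_le_one]
    apply ENNReal.ofReal_le_ofReal
    rw [intervalIntegral.integral_sub (by simp) (by simp)]
    simp
    norm_num
  · exact (Continuous.continuousOn (by fun_prop)).integrableOn_Icc
  · filter_upwards [ae_restrict_mem measurableSet_Icc] with x hx
    simp only [Pi.zero_apply]
    linarith [hx.2]

lemma volume_triSet (a b c : EuclideanSpace ℝ (Fin 2)) :
    volume (triSet a b c) ≤ ENNReal.ofReal (|orient a b c| / 2) := by
  let A : Matrix (Fin 2) (Fin 2) ℝ := !![b 0 - a 0, c 0 - a 0; b 1 - a 1, c 1 - a 1]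
  let T : Set (Fin 2 → ℝ) := {x | 0 ≤ x 0 ∧ 0 ≤ x 1 ∧ x 0 + x 1 ≤ 1}
  have hT : volume T ≤ ENNReal.ofReal (1 / 2) := by
    have := (volume_preserving_finTwoArrow ℝ).measure_preimage_equiv
      {x : ℝ × ℝ | 0 ≤ x.1 ∧ 0 ≤ x.2 ∧ x.1 + x.2 ≤ 1}
    refine le_trans (le_of_eq ?_) volume_stdtri
    rw [← this]
    rfl
  have himg : triSet a b c = (fun x => a + x) '' ((MeasurableEquiv.toLp 2 (Fin 2 → ℝ)).symm ⁻¹'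
      (Matrix.toLin' A '' T)) := by
    ext x
    constructor
    · rintro ⟨s, t, hs, ht, hst, rfl⟩
      refine ⟨s • (b - a) + t • (c - a), ⟨![s, t], ⟨by simpa, by simpa, by simpa⟩, ?_⟩, by simp [add_assoc]⟩
      ext i
      fin_cases i <;> simp [A, Matrix.mulVec, dotProduct] <;> ring
    · rintro ⟨y, ⟨v, ⟨h0, h1, h2⟩, hv⟩, rfl⟩
      refine ⟨v 0, v 1, h0, h1, h2, ?_⟩
      have e0 := congrFun hv 0
      have e1 := congrFun hv 1
      simp [A, Matrix.mulVec, dotProduct] at e0 e1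
      apply E_ext
      · simp; linarith
      · simp; linarith
  rw [himg, Set.image_add_left, measure_preimage_add,
    (EuclideanSpace.volume_preserving_symm_measurableEquiv_toLp (Fin 2)).measure_preimage_equiv,
    Measure.addHaar_image_linearMap, LinearMap.det_toLin']
  have : A.det = orient a b c := by
    simp [A, Matrix.det_fin_two, orient]; ring
  rw [this]
  calc _ ≤ ENNReal.ofReal |orient a b c| * ENNReal.ofReal (1 / 2) := by gcongr
    _ = _ := by rw [← ENNReal.ofReal_mul (abs_nonneg _)]; congr 1; ring

lemma mem_triSet (a b c x : EuclideanSpace ℝ (Fin 2)) (h : 0 < orient a b c)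
    (h1 : 0 ≤ orient a b x) (h2 : orient a c x ≤ 0) (h3 : 0 ≤ orient b c x) : x ∈ triSet a b c := by
  refine ⟨-orient a c x / orient a b c, orient a b x / orient a b c,
    div_nonneg (by linarith) h.le, div_nonneg h1 h.le, ?_, ?_⟩
  · rw [← add_div, div_le_one h]
    have : orient a b c - (-orient a c x + orient a b x) = orient b c x := by
      simp only [orient]; ring
    linarith
  · have hne := h.ne'
    apply E_ext
    · simp only [PiLp.add_apply, PiLp.smul_apply, PiLp.sub_apply, smul_eq_mul]
      field_simp
      simp only [orient]; ring
    · simp only [PiLp.add_apply, PiLp.smul_apply, PiLp.sub_apply, smul_eq_mul]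
      field_simp
      simp only [orient]; ring

lemma orient_hull (S : Set (EuclideanSpace ℝ (Fin 2))) (a b : EuclideanSpace ℝ (Fin 2))
    (h : ∀ x ∈ S, 0 ≤ orient a b x) : ∀ x ∈ convexHull ℝ S, 0 ≤ orient a b x := by
  have hc : Convex ℝ {x | 0 ≤ orient a b x} := by
    intro x hx y hy s t hs ht hst
    have : orient a b (s • x + t • y) = s * orient a b x + t * orient a b y := by
      have : s = 1 - t := by linarith
      subst this
      simp only [orient, PiLp.add_apply, PiLp.smul_apply, smul_eq_mul]; ring
    show 0 ≤ orient a b (s • x + t • y)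
    rw [this]
    exact add_nonneg (mul_nonneg hs hx) (mul_nonneg ht hy)
  exact fun x hx => convexHull_min h hc hx

lemma fan_cover (m : ℕ) (hm : 3 ≤ m) (p : ℕ → EuclideanSpace ℝ (Fin 2))
    (hp : ∀ i j k, i < j → j < k → k < m → 0 < orient (p i) (p j) (p k))
    (S : Set (EuclideanSpace ℝ (Fin 2))) (hS : ∀ x ∈ S, ∃ i < m, p i = x)
    (x : EuclideanSpace ℝ (Fin 2)) (hx : x ∈ convexHull ℝ S) :
    ∃ i ∈ Finset.Ico 1 (m - 1), x ∈ triSet (p 0) (p i) (p (i + 1)) := by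
  have edge : ∀ i, i + 1 < m → 0 ≤ orient (p i) (p (i + 1)) x := by
    intro i hi
    refine orient_hull S _ _ ?_ x hx
    intro y hy
    obtain ⟨j, hj, rfl⟩ := hS y hy
    have sw : orient (p i) (p (i + 1)) (p j) = orient (p j) (p i) (p (i + 1)) := by
      simp only [orient]; ring
    rcases lt_or_ge j i with h | h
    · rw [sw]; exact (hp j i (i + 1) h (by omega) hi).le
    rcases eq_or_lt_of_le h with h | h
    · subst h; simp [orient]
    rcases eq_or_lt_of_le (Nat.succ_le_of_lt h) with h' | h'
    · subst h'; simp only [orient]; apply le_of_eq; simp only [Nat.succ_eq_add_one]; ring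
    · exact (hp i (i + 1) j (by omega) h' hj).le
  have last : 0 ≤ orient (p (m - 1)) (p 0) x := by
    refine orient_hull S _ _ ?_ x hx
    intro y hy
    obtain ⟨j, hj, rfl⟩ := hS y hy
    rcases Nat.eq_zero_or_pos j with h | h
    · subst h; simp only [orient]; apply le_of_eq; ring
    rcases eq_or_lt_of_le (Nat.le_sub_one_of_lt hj) with h' | h'
    · subst h'; simp [orient]
    · have := (hp 0 j (m - 1) h h' (by omega)).le
      simp only [orient] at *; linarith
  by_contra hcon
  push Not at hcon
  have all : ∀ i, 1 ≤ i → i < m → 0 ≤ orient (p 0) (p i) x ∧ (2 ≤ i → 0 < orient (p 0) (p i) x) := by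
    intro i hi
    induction i, hi using Nat.le_induction with
    | base => intro _; exact ⟨edge 0 (by omega), by omega⟩
    | succ i hi ih =>
      intro him
      have ih := (ih (by omega)).1
      have : 0 < orient (p 0) (p (i + 1)) x := by
        by_contra hneg
        exact hcon i (by simp; omega) (mem_triSet _ _ _ _ (hp 0 i (i + 1) (by omega) (by omega) him)
          ih (not_lt.1 hneg) (edge i him))
      exact ⟨this.le, fun _ => this⟩
  have := (all (m - 1) (by omega) (by omega)).2 (by omega)
  simp only [orient] at *; linarith

lemma fan_volume (m : ℕ) (hm : 3 ≤ m) (p : ℕ → EuclideanSpace ℝ (Fin 2))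
    (hp : ∀ i j k, i < j → j < k → k < m → 0 < orient (p i) (p j) (p k))
    (S : Set (EuclideanSpace ℝ (Fin 2))) (hS : ∀ x ∈ S, ∃ i < m, p i = x) :
    (volume (convexHull ℝ S)).toReal
      ≤ (∑ i ∈ Finset.Ico 1 (m - 1), orient (p 0) (p i) (p (i + 1))) / 2 := by
  have hnn : ∀ i ∈ Finset.Ico 1 (m - 1), 0 ≤ orient (p 0) (p i) (p (i + 1)) := by
    intro i hi
    have hi := Finset.mem_Ico.1 hi
    exact (hp 0 i (i + 1) (by omega) (by omega) (by omega)).le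
  apply ENNReal.toReal_le_of_le_ofReal
  · exact div_nonneg (Finset.sum_nonneg hnn) (by norm_num)
  calc volume (convexHull ℝ S) ≤ volume (⋃ i ∈ Finset.Ico 1 (m - 1), triSet (p 0) (p i) (p (i + 1))) := by
        apply measure_mono
        intro x hx
        obtain ⟨i, hi, h⟩ := fan_cover m hm p hp S hS x hx
        exact Set.mem_biUnion hi h
    _ ≤ ∑ i ∈ Finset.Ico 1 (m - 1), volume (triSet (p 0) (p i) (p (i + 1))) :=
        measure_biUnion_finset_le _ _
    _ ≤ ∑ i ∈ Finset.Ico 1 (m - 1), ENNReal.ofReal (orient (p 0) (p i) (p (i + 1)) / 2) := by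
        refine Finset.sum_le_sum fun i hi => ?_
        refine (volume_triSet _ _ _).trans ?_
        rw [abs_of_nonneg (hnn i hi)]
    _ = _ := by
        rw [← ENNReal.ofReal_sum_of_nonneg, Finset.sum_div]
        intro i hi
        have := hnn i hi
        linarith

lemma two_point_volume (a b : EuclideanSpace ℝ (Fin 2)) (S : Set (EuclideanSpace ℝ (Fin 2)))
    (hS : ∀ x ∈ S, x = a ∨ x = b) : volume (convexHull ℝ S) = 0 := by
  have h : convexHull ℝ S ⊆ triSet a b b := by
    have : convexHull ℝ S ⊆ segment ℝ a b := by
      refine convexHull_min ?_ (convex_segment a b)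
      intro x hx
      rcases hS x hx with rfl | rfl
      · exact left_mem_segment ℝ _ _
      · exact right_mem_segment ℝ _ _
    refine this.trans ?_
    rw [segment_eq_image']
    rintro x ⟨t, ht, rfl⟩
    exact ⟨t, 0, ht.1, le_rfl, by simpa using ht.2, by simp⟩
  refine measure_mono_null h ?_
  rw [← nonpos_iff_eq_zero]
  refine (volume_triSet a b b).trans ?_
  have : orient a b b = 0 := by simp only [orient]; ring
  simp [this]

lemma enum_by_key {α : Type*} [DecidableEq α] (Q : Finset α) (key : α → ℝ) (hinj : Set.InjOn key Q) (d : α) :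
    ∃ q : ℕ → α, (∀ i < Q.card, q i ∈ Q) ∧ (∀ x ∈ Q, ∃ i < Q.card, q i = x) ∧
      ∀ i j, i < j → j < Q.card → key (q i) < key (q j) := by
  induction Q using Finset.induction_on_max_value key with
  | empty => exact ⟨fun _ => d, by simp, by simp, by simp⟩
  | insert a s ha hmax ih =>
    obtain ⟨q, h1, h2, h3⟩ := ih (hinj.mono (by simp))
    rw [Finset.card_insert_of_notMem ha]
    refine ⟨fun i => if i < s.card then q i else a, ?_, ?_, ?_⟩
    · intro i _
      by_cases hi : i < s.card
      · simp [hi, h1 i hi]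
      · simp [hi]
    · intro x hx
      rcases Finset.mem_insert.1 hx with rfl | hx
      · exact ⟨s.card, by omega, by simp⟩
      · obtain ⟨i, hi, rfl⟩ := h2 x hx
        exact ⟨i, by omega, by simp [hi]⟩
    · intro i j hij hj
      have hi : i < s.card := by omega
      by_cases hj' : j < s.card
      · simp only [hi, hj', if_true]; exact h3 i j hij hj'
      · simp only [hi, hj', if_true, if_false]
        refine lt_of_le_of_ne (hmax _ (h1 i hi)) fun h => ha ?_
        have := hinj (by simp [h1 i hi]) (by simp) h
        rw [← this]; exact h1 i hi

lemma tri_mem_hull (C : Set (EuclideanSpace ℝ (Fin 2))) (hC : Convex ℝ C)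
    {a b c : EuclideanSpace ℝ (Fin 2)} (ha : a ∈ C) (hb : b ∈ C) (hc : c ∈ C) :
    triSet a b c ⊆ C := by
  rintro x ⟨s, t, hs, ht, hst, rfl⟩
  have := hC.sum_mem (t := Finset.univ) (w := ![1 - s - t, s, t]) (z := ![a, b, c])
    (by intro i _; fin_cases i <;> simp <;> linarith) (by simp [Fin.sum_univ_three]; ring)
    (by intro i _; fin_cases i <;> simpa)
  convert this using 1
  simp [Fin.sum_univ_three]
  module

lemma crs_arg (v w : ℂ) : v.re * w.im - v.im * w.re = ‖v‖ * ‖w‖ * sin (w.arg - v.arg) := by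
  rw [sin_sub]
  have h1 := Complex.norm_mul_cos_arg v
  have h2 := Complex.norm_mul_sin_arg v
  have h3 := Complex.norm_mul_cos_arg w
  have h4 := Complex.norm_mul_sin_arg w
  rw [← h1, ← h2, ← h3, ← h4]
  simp only [h1, h2, h3, h4]
  nth_rewrite 1 [← h1, ← h4, ← h2, ← h3]
  ring

lemma convex_order (P : Finset (EuclideanSpace ℝ (Fin 2))) (hne : P.Nonempty)
    (hP : ∀ p ∈ P, p ∉ convexHull ℝ ((P.erase p : Finset _) : Set (EuclideanSpace ℝ (Fin 2)))) :
    ∃ p : ℕ → EuclideanSpace ℝ (Fin 2), (∀ i < P.card, p i ∈ P) ∧ (∀ x ∈ P, ∃ i < P.card, p i = x) ∧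
      ∀ i j k, i < j → j < k → k < P.card → 0 < orient (p i) (p j) (p k) := by
  obtain ⟨o, ho, hmin⟩ := P.exists_min_image (fun p => toLex (p 0, p 1)) hne
  let V : EuclideanSpace ℝ (Fin 2) → ℂ := fun p => ⟨p 0 - o 0, p 1 - o 1⟩
  have hV : ∀ q ∈ P, q ≠ o → V q ≠ 0 := by
    intro q _ hqo h
    apply hqo
    have h0 := congrArg Complex.re h
    have h1 := congrArg Complex.im h
    simp [V] at h0 h1
    exact E_ext (by linarith) (by linarith)
  have hnotin : ∀ a ∈ P, ∀ b ∈ P, ∀ x ∈ P, x ≠ o → x ≠ a → x ≠ b → x ∉ triSet o a b := by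
    intro a ha b hb x hx h1 h2 h3 hmem
    refine hP x hx (tri_mem_hull _ (convex_convexHull ℝ _) ?_ ?_ ?_ hmem)
    · exact subset_convexHull ℝ _ (by simp [ho, h1.symm])
    · exact subset_convexHull ℝ _ (by simp [ha, h2.symm])
    · exact subset_convexHull ℝ _ (by simp [hb, h3.symm])
  let key : EuclideanSpace ℝ (Fin 2) → ℝ := fun p => (V p).arg
  have hkey : ∀ q ∈ P, q ≠ o → -(π / 2) < key q ∧ key q ≤ π / 2 := by
    intro q hq hqo
    have := hmin q hq
    rw [Prod.Lex.toLex_le_toLex] at this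
    simp only at this
    constructor
    · rw [Complex.neg_pi_div_two_lt_arg_iff]
      rcases this with h | ⟨h, h'⟩
      · left; simp only [V]; linarith
      · right; simp only [V]; linarith
    · rw [Complex.arg_le_pi_div_two_iff]
      left
      rcases this with h | ⟨h, h'⟩ <;> simp only [V] <;> linarith
  have hor : ∀ a b, orient o a b = ‖V a‖ * ‖V b‖ * sin (key b - key a) := by
    intro a b
    rw [← crs_arg]; rfl
  have hpos : ∀ a ∈ P, ∀ b ∈ P, a ≠ o → b ≠ o → key a < key b → 0 < orient o a b := by
    intro a ha b hb hao hbo hab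
    rw [hor]
    have h1 := norm_pos_iff.2 (hV a ha hao)
    have h2 := norm_pos_iff.2 (hV b hb hbo)
    have h3 := sin_pos_of_pos_of_lt_pi (x := key b - key a) (by linarith)
      (by linarith [(hkey a ha hao).1, (hkey b hb hbo).2])
    positivity
  have hcol : ∀ a ∈ P, ∀ b ∈ P, a ≠ o → b ≠ o → a ≠ b → key a = key b → ‖V b‖ ≤ ‖V a‖ → False := by
    intro a ha b hb hao hbo hab hk hle
    have h1 := norm_pos_iff.2 (hV a ha hao)
    have h2 := norm_pos_iff.2 (hV b hb hbo)
    have := (Complex.arg_eq_arg_iff (hV a ha hao) (hV b hb hbo)).1 hk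
    refine hnotin a ha a ha b hb hbo hab.symm hab.symm ⟨‖V b‖ / ‖V a‖, 0, by positivity, le_rfl, ?_, ?_⟩
    · rw [add_zero, div_le_one h1]; exact hle
    · have e : ((‖V b‖ / ‖V a‖ : ℝ) : ℂ) * V a = V b := by push_cast; exact this
      have e0 := congrArg Complex.re e
      have e1 := congrArg Complex.im e
      rw [Complex.re_ofReal_mul] at e0
      rw [Complex.im_ofReal_mul] at e1
      apply E_ext
      · simp only [PiLp.add_apply, PiLp.smul_apply, PiLp.sub_apply, smul_eq_mul, zero_mul, add_zero]
        change _ * (a 0 - o 0) = b 0 - o 0 at e0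
        linarith
      · simp only [PiLp.add_apply, PiLp.smul_apply, PiLp.sub_apply, smul_eq_mul, zero_mul, add_zero]
        change _ * (a 1 - o 1) = b 1 - o 1 at e1
        linarith
  have hinj : Set.InjOn key (P.erase o : Finset _) := by
    intro a ha b hb hk
    have ha' := Finset.mem_erase.1 (Finset.mem_coe.1 ha)
    have hb' := Finset.mem_erase.1 (Finset.mem_coe.1 hb)
    by_contra hab
    rcases le_total ‖V b‖ ‖V a‖ with h | h
    · exact hcol a ha'.2 b hb'.2 ha'.1 hb'.1 hab hk h
    · exact hcol b hb'.2 a ha'.2 hb'.1 ha'.1 (Ne.symm hab) hk.symm h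
  obtain ⟨q, q1, q2, q3⟩ := enum_by_key (P.erase o) key hinj o
  have hcard : (P.erase o).card + 1 = P.card := Finset.card_erase_add_one ho
  have q1' : ∀ i < (P.erase o).card, q i ≠ o ∧ q i ∈ P := fun i hi => Finset.mem_erase.1 (q1 i hi)
  have hqq : ∀ i j, i < j → j < (P.erase o).card → 0 < orient o (q i) (q j) := by
    intro i j hij hj
    exact hpos _ (q1' i (by omega)).2 _ (q1' j hj).2 (q1' i (by omega)).1 (q1' j hj).1 (q3 i j hij hj)
  have hne' : ∀ i j, i < j → j < (P.erase o).card → q i ≠ q j := by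
    intro i j hij hj h
    have := q3 i j hij hj
    rw [h] at this; exact lt_irrefl _ this
  refine ⟨fun i => Nat.casesOn i o q, ?_, ?_, ?_⟩
  · intro i hi
    cases i with
    | zero => exact ho
    | succ i => exact (q1' i (by omega)).2
  · intro x hx
    by_cases hxo : x = o
    · exact ⟨0, by omega, hxo.symm⟩
    · obtain ⟨i, hi, h⟩ := q2 x (Finset.mem_erase.2 ⟨hxo, hx⟩)
      exact ⟨i + 1, by omega, h⟩
  · intro i j k hij hjk hk
    obtain ⟨j, rfl⟩ : ∃ j', j = j' + 1 := ⟨j - 1, by omega⟩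
    obtain ⟨k, rfl⟩ : ∃ k', k = k' + 1 := ⟨k - 1, by omega⟩
    cases i with
    | zero => exact hqq j k (by omega) (by omega)
    | succ i =>
      change 0 < orient (q i) (q j) (q k)
      by_contra hneg
      refine hnotin (q i) (q1' i (by omega)).2 (q k) (q1' k (by omega)).2 (q j) (q1' j (by omega)).2
        (q1' j (by omega)).1 (hne' i j (by omega) (by omega)).symm (hne' j k (by omega) (by omega)) ?_
      refine mem_triSet _ _ _ _ (hqq i k (by omega) (by omega)) (hqq i j (by omega) (by omega)).le ?_ ?_
      · have := hqq j k (by omega) (by omega)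
        simp only [orient] at *; linarith
      · simp only [orient] at *; linarith

lemma unimodal_sum (m : ℕ) (hm : 0 < m) (g : ℕ → ℝ) (W : ℝ) (hper : g m = g 0)
    (hmin : ∀ i < m, g 0 ≤ g i) (hW : ∀ i < m, g i - g 0 ≤ W)
    (hv : ∀ i j k, 0 < i → i < j → j < k → k < m → g j < g i → g j < g k → False) :
    ∑ i ∈ Finset.range m, |g (i + 1) - g i| ≤ 2 * W := by
  obtain ⟨M, hM, hmax⟩ := (Finset.range m).exists_max_image g ⟨0, by simpa⟩
  have hM := Finset.mem_range.1 hM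
  have hmax : ∀ i < m, g i ≤ g M := fun i hi => hmax i (Finset.mem_range.2 hi)
  have up : ∀ i < M, g i ≤ g (i + 1) := by
    intro i hi
    by_contra h
    push Not at h
    have i0 : 0 < i := by
      rcases Nat.eq_zero_or_pos i with rfl | h'
      · have := hmin 1 (by omega); simp at h; linarith
      · exact h'
    have iM : i + 1 < M := by
      rcases eq_or_lt_of_le (Nat.succ_le_of_lt hi) with h' | h'
      · have := hmax i (by omega); rw [← h'] at this; simp only [Nat.succ_eq_add_one] at this; linarith
      · exact h'
    exact hv i (i + 1) M i0 (by omega) iM hM h (lt_of_lt_of_le h (hmax i (by omega)))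
  have down : ∀ i, M ≤ i → i < m → g (i + 1) ≤ g i := by
    intro i hi him
    by_contra h
    push Not at h
    have i1 : i + 1 < m := by
      rcases eq_or_lt_of_le (Nat.succ_le_of_lt him) with h' | h'
      · have := hmin i him; simp only [Nat.succ_eq_add_one] at h'; rw [h', hper] at h; linarith
      · exact h'
    have h2 := hmax (i + 1) i1
    have hMi : M < i := by
      rcases eq_or_lt_of_le hi with h' | h'
      · subst h'; linarith
      · exact h'
    have M0 : 0 < M := by
      rcases Nat.eq_zero_or_pos M with rfl | h'
      · have := hmin i him; linarith
      · exact h'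
    exact hv M i (i + 1) M0 hMi (by omega) i1 (by linarith) h
  rw [Finset.range_eq_Ico, ← Finset.sum_Ico_consecutive _ (Nat.zero_le M) hM.le]
  have A : ∑ i ∈ Finset.Ico 0 M, |g (i + 1) - g i| = ∑ i ∈ Finset.Ico 0 M, (g (i + 1) - g i) :=
    Finset.sum_congr rfl fun i hi => abs_of_nonneg (sub_nonneg.2 (up i (Finset.mem_Ico.1 hi).2))
  have B : ∑ i ∈ Finset.Ico M m, |g (i + 1) - g i| = ∑ i ∈ Finset.Ico M m, -(g (i + 1) - g i) :=
    Finset.sum_congr rfl fun i hi => abs_of_nonpos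
      (sub_nonpos.2 (down i (Finset.mem_Ico.1 hi).1 (Finset.mem_Ico.1 hi).2))
  rw [A, B, Finset.sum_neg_distrib, Finset.sum_Ico_sub _ (Nat.zero_le M), Finset.sum_Ico_sub _ hM.le, hper]
  linarith [hW M hM]

lemma periodic_sum (m : ℕ) (f : ℕ → ℝ) (hf : ∀ i, f (i + m) = f i) (a : ℕ) :
    ∑ i ∈ Finset.range m, f (a + i) = ∑ i ∈ Finset.range m, f i := by
  induction a with
  | zero => simp
  | succ a ih =>
    rw [← ih]
    have h1 := Finset.sum_range_succ (fun i => f (a + i)) m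
    have h2 := Finset.sum_range_succ' (fun i => f (a + i)) m
    rw [hf] at h1
    simp only [add_zero] at h2
    have : ∑ i ∈ Finset.range m, f (a + 1 + i) = ∑ i ∈ Finset.range m, f (a + (i + 1)) :=
      Finset.sum_congr rfl fun i _ => by congr 1; ring
    linarith

lemma width_sum (m : ℕ) (hm : 0 < m) (p : ℕ → EuclideanSpace ℝ (Fin 2)) (hper : ∀ i, p (i + m) = p i)
    (hp : ∀ i j k, i < j → j < k → k < i + m → 0 < orient (p i) (p j) (p k)) (a b W : ℝ)
    (hW : ∀ i j, (a * p i 0 + b * p i 1) - (a * p j 0 + b * p j 1) ≤ W) :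
    ∑ i ∈ Finset.range m, |(a * p (i + 1) 0 + b * p (i + 1) 1) - (a * p i 0 + b * p i 1)| ≤ 2 * W := by
  let g : ℕ → ℝ := fun i => a * p i 0 + b * p i 1
  have gper : ∀ i, g (i + m) = g i := fun i => by simp only [g, hper]
  obtain ⟨N, hN, hmin⟩ := (Finset.range m).exists_min_image g ⟨0, by simpa⟩
  have hmin' : ∀ i, g N ≤ g i := by
    intro i
    have : g i = g (i % m) := by
      conv_lhs => rw [← Nat.mod_add_div i m]
      generalize i / m = t
      induction t with
      | zero => simp
      | succ t ih => rw [mul_add, mul_one, ← add_assoc, gper, ih]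
    rw [this]
    exact hmin _ (Finset.mem_range.2 (Nat.mod_lt _ hm))
  have := periodic_sum m (fun i => |g (i + 1) - g i|) (fun i => by
    simp only [gper]; rw [show i + m + 1 = i + 1 + m by ring, gper]) N
  change ∑ i ∈ Finset.range m, |g (i + 1) - g i| ≤ 2 * W
  rw [← this]
  refine unimodal_sum m hm (fun i => g (N + i)) W (gper N) (fun i _ => hmin' _) (fun i _ => hW _ _) ?_
  intro i j k hi hij hjk hk h1 h2
  have d1 := hp (N + i) (N + j) (N + k) (by omega) (by omega) (by omega)
  have d2 := hp N (N + j) (N + k) (by omega) (by omega) (by omega)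
  have d3 := hp N (N + i) (N + k) (by omega) (by omega) (by omega)
  have d4 := hp N (N + i) (N + j) (by omega) (by omega) (by omega)
  have h0 := hmin' (N + j)
  have id1 : orient (p (N + i)) (p (N + j)) (p (N + k)) + orient (p N) (p (N + i)) (p (N + k))
      = orient (p N) (p (N + j)) (p (N + k)) + orient (p N) (p (N + i)) (p (N + j)) := by
    simp only [orient]; ring
  have id2 : orient (p (N + i)) (p (N + j)) (p (N + k)) * g N
      + orient (p N) (p (N + i)) (p (N + k)) * g (N + j)
      = orient (p N) (p (N + j)) (p (N + k)) * g (N + i)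
      + orient (p N) (p (N + i)) (p (N + j)) * g (N + k) := by
    simp only [orient, g]; ring
  have e1 := mul_le_mul_of_nonneg_left h0 d1.le
  have e2 := mul_lt_mul_of_pos_left h1 d2
  have e3 := mul_lt_mul_of_pos_left h2 d4
  have e4 := congrArg (· * g (N + j)) id1
  simp only [add_mul] at e4
  linarith

lemma dist_one_width (x y : EuclideanSpace ℝ (Fin 2)) (h : dist x y ≤ 1) (θ : ℝ) :
    (sin θ * x 0 + -cos θ * x 1) - (sin θ * y 0 + -cos θ * y 1) ≤ 1 := by
  rw [EuclideanSpace.dist_eq, Fin.sum_univ_two, Real.dist_eq, Real.dist_eq, sq_abs, sq_abs] at h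
  have h2 : (x 0 - y 0) ^ 2 + (x 1 - y 1) ^ 2 ≤ 1 := by
    have := (Real.sqrt_le_left (by norm_num)).1 h
    linarith
  have := sin_sq_add_cos_sq θ
  nlinarith [sq_nonneg (sin θ - (x 0 - y 0)), sq_nonneg (cos θ + (x 1 - y 1))]

lemma orient_mod (m : ℕ) (hm : 0 < m) (p : ℕ → EuclideanSpace ℝ (Fin 2))
    (hp : ∀ i j k, i < j → j < k → k < m → 0 < orient (p i) (p j) (p k))
    (i j k : ℕ) (hij : i < j) (hjk : j < k) (hk : k < i + m) :
    0 < orient (p (i % m)) (p (j % m)) (p (k % m)) := by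
  have cyc : ∀ a b c, orient a b c = orient b c a := by intro a b c; simp only [orient]; ring
  have hi := Nat.mod_add_div i m
  have hlt := Nat.mod_lt i hm
  have md : ∀ j, i ≤ j → j < i + m →
      (j % m = i % m + (j - i) ∧ i % m + (j - i) < m) ∨
      (j % m + m = i % m + (j - i) ∧ m ≤ i % m + (j - i)) := by
    intro j h1 h2
    have e : j = i % m + (j - i) + m * (i / m) := by omega
    have e2 : j % m = (i % m + (j - i)) % m := by
      conv_lhs => rw [e]
      rw [Nat.add_mul_mod_self_left]
    by_cases h : i % m + (j - i) < m
    · left; rw [e2, Nat.mod_eq_of_lt h]; exact ⟨rfl, h⟩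
    · right
      rw [e2, Nat.mod_eq_sub_mod (by omega), Nat.mod_eq_of_lt (by omega)]
      omega
  rcases md j (by omega) (by omega) with ⟨a1, a2⟩ | ⟨a1, a2⟩
  · rcases md k (by omega) (by omega) with ⟨b1, b2⟩ | ⟨b1, b2⟩
    · exact hp _ _ _ (by omega) (by omega) (by omega)
    · rw [cyc, cyc]; exact hp _ _ _ (by omega) (by omega) (by omega)
  · rcases md k (by omega) (by omega) with ⟨b1, b2⟩ | ⟨b1, b2⟩
    · omega
    · rw [cyc]; exact hp _ _ _ (by omega) (by omega) (by omega)

lemma bound_nonneg (n : ℕ) (hn : 3 ≤ n) :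
    0 ≤ n * sin (π / (2 * n)) ^ 2 * (cos (π / n) / sin (π / n)) := by
  have hcot : 0 ≤ cos (π / n) / sin (π / n) := by
    have h3 : (3 : ℝ) ≤ n := by exact_mod_cast hn
    have : π / n ≤ π / 2 := div_le_div_of_nonneg_left pi_pos.le (by norm_num) (by linarith)
    have p : 0 ≤ π / n := by positivity
    exact div_nonneg (cos_nonneg_of_neg_pi_div_two_le_of_le (by linarith [pi_pos]) this)
      (sin_nonneg_of_nonneg_of_le_pi p (by linarith [pi_pos]))
  positivity

lemma bound_convex (n : ℕ) (hn : 3 ≤ n) (P : Finset (EuclideanSpace ℝ (Fin 2))) (hcard : P.card ≤ n)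
    (hd : ∀ p ∈ P, ∀ q ∈ P, dist p q ≤ 1)
    (hP : ∀ p ∈ P, p ∉ convexHull ℝ ((P.erase p : Finset _) : Set (EuclideanSpace ℝ (Fin 2)))) :
    (volume (convexHull ℝ (P : Set (EuclideanSpace ℝ (Fin 2))))).toReal
          ≤ n * sin (π / (2 * n)) ^ 2 * (cos (π / n) / sin (π / n)) := by
  rcases P.eq_empty_or_nonempty with rfl | hne
  · simpa using bound_nonneg n hn
  obtain ⟨p, p1, p2, p3⟩ := convex_order P hne hP
  have hm0 : 0 < P.card := hne.card_pos
  generalize hm : P.card = m at *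
  by_cases hm3 : m < 3
  · rw [two_point_volume (p 0) (p 1)]
    · simpa using bound_nonneg n hn
    · intro x hx
      obtain ⟨i, hi, rfl⟩ := p2 x hx
      have : i = 0 ∨ i = 1 := by omega
      rcases this with rfl | rfl <;> simp
  have hm3 : 3 ≤ m := by omega
  have hvol := fan_volume m hm3 p p3 P (fun x hx => p2 x hx)
  let z : ℕ → ℂ := fun i => if i < m then ⟨p i 0 - p 0 0, p i 1 - p 0 1⟩ else 0
  have z0 : z 0 = 0 := by
    simp only [z, hm0, if_true, sub_self]; rfl
  have zm : ∀ i, m ≤ i → z i = 0 := fun i hi => by simp [z, hi]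
  have zmod : ∀ i, i ≤ m → z i = ⟨p (i % m) 0 - p 0 0, p (i % m) 1 - p 0 1⟩ := by
    intro i hi
    rcases eq_or_lt_of_le hi with rfl | h
    · rw [zm _ le_rfl, Nat.mod_self, sub_self, sub_self]; rfl
    · rw [Nat.mod_eq_of_lt h]; simp [z, h]
  have hper : ∑ i ∈ Finset.range n, ‖z (i + 1) - z i‖ ≤ 2 * n * sin (π / (2 * n)) := by
    apply reinhardt n (by omega) (fun i => z (i + 1) - z i)
    intro θ
    have hw := width_sum m hm0 (fun i => p (i % m)) (fun i => by simp)
      (orient_mod m hm0 p p3) (sin θ) (-cos θ) 1 (fun i j =>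
        dist_one_width _ _ (hd _ (p1 _ (Nat.mod_lt _ hm0)) _ (p1 _ (Nat.mod_lt _ hm0))) θ)
    rw [← Finset.sum_subset (s₁ := Finset.range m) (by simpa using hcard)]
    · refine le_trans (le_of_eq (Finset.sum_congr rfl fun i hi => ?_)) (hw.trans (by norm_num))
      have hi := Finset.mem_range.1 hi
      rw [zmod i hi.le, zmod (i + 1) hi]
      simp only [Complex.sub_re, Complex.sub_im]
      congr 1; ring
    · intro i _ hi
      have hi : m ≤ i := by simpa using hi
      simp [zm i hi, zm (i + 1) (by omega)]
  have hiso := isoperimetric n hn z z0 (fun k hk => zm k (by omega)) _ hper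
  have harea : ∑ i ∈ Finset.range n, crs (z i) (z (i + 1))
      = ∑ i ∈ Finset.Ico 1 (m - 1), orient (p 0) (p i) (p (i + 1)) := by
    rw [← Finset.sum_subset (s₁ := Finset.Ico 1 (m - 1))]
    · refine Finset.sum_congr rfl fun i hi => ?_
      have hi := Finset.mem_Ico.1 hi
      have a : i < m := by omega
      have b : i + 1 < m := by omega
      simp only [z, a, b, if_true, crs, orient]
    · intro i hi
      have hi := Finset.mem_Ico.1 hi
      exact Finset.mem_range.2 (by omega)
    · intro i _ hi
      have hi : i = 0 ∨ m ≤ i + 1 := by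
        rw [Finset.mem_Ico] at hi; omega
      rcases hi with rfl | hi
      · simp [z0, crs]
      · simp [zm _ hi, crs]
  rw [harea] at hiso
  have hn' : (n : ℝ) ≠ 0 := by positivity
  have e : cos (π / n) / sin (π / n) * ((2 * n * sin (π / (2 * n))) ^ 2 / n)
      = 4 * (n * sin (π / (2 * n)) ^ 2 * (cos (π / n) / sin (π / n))) := by
    have : (2 * n * sin (π / (2 * n))) ^ 2 / n = 4 * (n * sin (π / (2 * n)) ^ 2) := by
      field_simp; ring
    rw [this]; ring
  rw [e] at hiso
  linarith

lemma bound_all (n : ℕ) (hn : 3 ≤ n) (c : ℕ) : ∀ P : Finset (EuclideanSpace ℝ (Fin 2)), P.card = c →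
    P.card ≤ n → (∀ p ∈ P, ∀ q ∈ P, dist p q ≤ 1) →
    (volume (convexHull ℝ (P : Set (EuclideanSpace ℝ (Fin 2))))).toReal
          ≤ n * sin (π / (2 * n)) ^ 2 * (cos (π / n) / sin (π / n)) := by
  induction c with
  | zero =>
    intro P hc _ _
    rw [Finset.card_eq_zero.1 hc]
    simpa using bound_nonneg n hn
  | succ c ih =>
    intro P hc hcard hd
    by_cases hP : ∀ p ∈ P, p ∉ convexHull ℝ ((P.erase p : Finset _) : Set (EuclideanSpace ℝ (Fin 2)))
    · exact bound_convex n hn P hcard hd hP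
    push Not at hP
    obtain ⟨p, hp, hmem⟩ := hP
    have hcc := Finset.card_erase_add_one hp
    have hsub : convexHull ℝ (P : Set (EuclideanSpace ℝ (Fin 2)))
        = convexHull ℝ ((P.erase p : Finset _) : Set (EuclideanSpace ℝ (Fin 2))) := by
      apply Set.Subset.antisymm
      · refine convexHull_min ?_ (convex_convexHull ℝ _)
        intro x hx
        by_cases h : x = p
        · rw [h]; exact hmem
        · exact subset_convexHull ℝ _ (Finset.mem_coe.2 (Finset.mem_erase.2 ⟨h, hx⟩))
      · exact convexHull_mono (Finset.coe_subset.2 (Finset.erase_subset _ _))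
    rw [hsub]
    exact ih (P.erase p) (by omega) (by omega)
      (fun a ha b hb => hd a (Finset.mem_of_mem_erase ha) b (Finset.mem_of_mem_erase hb))

/-- For every `n ≥ 3`, any set of at most `n` points in the plane with pairwise
Euclidean distances at most `1` has convex hull of area at most
`n · sin²(π/(2n)) · cos(π/n)/sin(π/n)`; in particular
`A*_n ≤ n · sin²(π/(2n)) · cot(π/n)`. -/
theorem maxArea_upper_bound :
    ∀ n : ℕ, 3 ≤ n →
      (∀ P : Finset (EuclideanSpace ℝ (Fin 2)), P.card ≤ n →
        (∀ p ∈ P, ∀ q ∈ P, dist p q ≤ 1) →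
        (volume (convexHull ℝ (P : Set (EuclideanSpace ℝ (Fin 2))))).toReal
          ≤ n * sin (π / (2 * n)) ^ 2 * (cos (π / n) / sin (π / n))) ∧
      maxArea n ≤ n * sin (π / (2 * n)) ^ 2 * (cos (π / n) / sin (π / n)) := by
  intro n hn
  have h : ∀ P : Finset (EuclideanSpace ℝ (Fin 2)), P.card ≤ n →
        (∀ p ∈ P, ∀ q ∈ P, dist p q ≤ 1) →
        (volume (convexHull ℝ (P : Set (EuclideanSpace ℝ (Fin 2))))).toReal
          ≤ n * sin (π / (2 * n)) ^ 2 * (cos (π / n) / sin (π / n)) :=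
    fun P h1 h2 => bound_all n hn P.card P rfl h1 h2
  refine ⟨h, ?_⟩
  refine Real.sSup_le ?_ (bound_nonneg n hn)
  rintro a ⟨P, h1, h2, rfl⟩
  exact h P h1 h2
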